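/- Let Γ be a finite simplicial graph satisfying property (NL). Then Aut(A_Γ) contains a poison subgroup: there exist elements x₁, x₂, x₃ ∈ A_Γ generating a free subgroup of rank 3 and automorphisms α₁, α₂ ∈ Aut(A_Γ) such that αᵢ(xⱼ) = xⱼ for all i,j ∈ {1,2} and αᵢ(x₃) = x₃xᵢ for i ∈ {1,2}. -/

import Mathlib

open SimpleGraph

namespace RaagPaper

variable {V : Type} [Fintype V] [DecidableEq V]

/-- The defining relations of the right-angled Artin group of a graph `Γ`. -/
def Rels (Γ : SimpleGraph V) : Set (FreeGroup V) :=
  {r | ∃ u v : V, Γ.Adj u v ∧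
    r = FreeGroup.of u * FreeGroup.of v * (FreeGroup.of u)⁻¹ * (FreeGroup.of v)⁻¹}

/-- The right-angled Artin group of `Γ`. -/
abbrev Raag (Γ : SimpleGraph V) := PresentedGroup (Rels Γ)

/-- The generator of `Raag Γ` corresponding to the vertex `v`. -/
def gen (Γ : SimpleGraph V) (v : V) : Raag Γ := PresentedGroup.of v

/-- The link of a vertex. -/
def lk (Γ : SimpleGraph V) (v : V) : Set V := Γ.neighborSet v

/-- The star of a vertex. -/
def st (Γ : SimpleGraph V) (v : V) : Set V := insert v (Γ.neighborSet v)

/-- The partial preorder `v ≤ w ↔ lk v ⊆ st w` on vertices. -/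
def Le (Γ : SimpleGraph V) (v w : V) : Prop := lk Γ v ⊆ st Γ w

/-- The equivalence `v ∼ w`. -/
def Sim (Γ : SimpleGraph V) (v w : V) : Prop := Le Γ v w ∧ Le Γ w v

/-- The equivalence class of a vertex under `∼`. -/
def simClass (Γ : SimpleGraph V) (v : V) : Set V := {u | Sim Γ u v}

/-- Property (B1): any two distinct non-adjacent vertices are `∼`-equivalent. -/
def B1 (Γ : SimpleGraph V) : Prop :=
  ∀ u v : V, u ≠ v → ¬ Γ.Adj u v → Sim Γ u v

/-- Property (B2). -/
def B2 (Γ : SimpleGraph V) : Prop :=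
  ∀ v w : V, v ≠ w → Le Γ v w → ∃ u : V, u ≠ v ∧ u ≠ w ∧ Le Γ v u ∧ Le Γ u w

/-- `α` is the transvection `t_{vw}` for some `v ≤ w`. -/
def IsTransvection (Γ : SimpleGraph V) (α : MulAut (Raag Γ)) : Prop :=
  ∃ v w : V, v ≠ w ∧ Le Γ v w ∧ α (gen Γ v) = gen Γ v * gen Γ w ∧
    ∀ z : V, z ≠ v → α (gen Γ z) = gen Γ z

/-- `Y` is (the vertex set of) a connected component of the subgraph of `Γ` induced on `S`. -/
def IsCompOf (Γ : SimpleGraph V) (S : Set V) (Y : Set V) : Prop :=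
  ∃ C : (Γ.induce S).ConnectedComponent, Y = Subtype.val '' C.supp

/-- `α` is a partial conjugation `c_{v,Y}`. -/
def IsPartialConj (Γ : SimpleGraph V) (α : MulAut (Raag Γ)) : Prop :=
  ∃ (v : V) (Y : Set V), IsCompOf Γ (st Γ v)ᶜ Y ∧
    (∀ y ∈ Y, α (gen Γ y) = (gen Γ v)⁻¹ * gen Γ y * gen Γ v) ∧
    (∀ z : V, z ∉ Y → α (gen Γ z) = gen Γ z)

/-- `α` is the inversion `ι_v`. -/
def IsInversion (Γ : SimpleGraph V) (α : MulAut (Raag Γ)) : Prop :=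
  ∃ v : V, α (gen Γ v) = (gen Γ v)⁻¹ ∧ ∀ z : V, z ≠ v → α (gen Γ z) = gen Γ z

/-- `SAut⁰(A_Γ)`: the subgroup generated by transvections and partial conjugations. -/
def SAut0 (Γ : SimpleGraph V) : Subgroup (MulAut (Raag Γ)) :=
  Subgroup.closure {α | IsTransvection Γ α ∨ IsPartialConj Γ α}

/-- `Aut⁰(A_Γ)`: the subgroup generated by transvections, partial conjugations and inversions. -/
def Aut0 (Γ : SimpleGraph V) : Subgroup (MulAut (Raag Γ)) :=
  Subgroup.closure {α | IsTransvection Γ α ∨ IsPartialConj Γ α ∨ IsInversion Γ α}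

/-- The natural map `Aut(A_Γ) → Aut(A_Γ^{ab})`. -/
def abAutHom (Γ : SimpleGraph V) :
    MulAut (Raag Γ) →* MulAut (Abelianization (Raag Γ)) :=
  MonoidHom.mk' (fun e => MulEquiv.abelianizationCongr e) (by
    intro e f
    exact (abelianizationCongr_trans f e).symm)

/-- The Torelli subgroup `IA_Γ`. -/
def IA (Γ : SimpleGraph V) : Subgroup (MulAut (Raag Γ)) := (abAutHom Γ).ker

/-- The subgroup of `m`-th powers of `A_Γ^{ab}`; the quotient by it is `A_Γ^{ab} ⊗ ℤ/mℤ`. -/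
def powN (Γ : SimpleGraph V) (m : ℕ) : Subgroup (Abelianization (Raag Γ)) :=
  (powMonoidHom m : Abelianization (Raag Γ) →* Abelianization (Raag Γ)).range

/-- `IA_Γ(m)`: the kernel of `Aut(A_Γ) → Aut(A_Γ^{ab} ⊗ ℤ/mℤ)`, i.e. the automorphisms
acting trivially on the abelianization modulo `m`-th powers. -/
def IAm (Γ : SimpleGraph V) (m : ℕ) : Subgroup (MulAut (Raag Γ)) where
  carrier := {α | ∀ x : Abelianization (Raag Γ), abAutHom Γ α x * x⁻¹ ∈ powN Γ m}
  one_mem' := by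
    intro x
    simp only [map_one, MulAut.one_apply, mul_inv_cancel]
    exact one_mem _
  mul_mem' := by
    intro a b ha hb x
    have h : abAutHom Γ (a * b) x * x⁻¹ =
        (abAutHom Γ a (abAutHom Γ b x) * (abAutHom Γ b x)⁻¹) * (abAutHom Γ b x * x⁻¹) := by
      simp only [map_mul, MulAut.mul_apply]
      group
    rw [h]
    exact mul_mem (ha _) (hb x)
  inv_mem' := by
    intro a ha x
    have h : abAutHom Γ a (abAutHom Γ a⁻¹ x) = x := by
      have : abAutHom Γ a * abAutHom Γ a⁻¹ = 1 := by
        rw [← map_mul, mul_inv_cancel, map_one]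
      calc abAutHom Γ a (abAutHom Γ a⁻¹ x) = (abAutHom Γ a * abAutHom Γ a⁻¹) x := rfl
        _ = x := by rw [this]; rfl
    have := inv_mem (ha (abAutHom Γ a⁻¹ x))
    rw [h] at this
    simpa [mul_comm] using this
  
/-- `SIA_Γ(m) = SAut⁰(A_Γ) ∩ IA_Γ(m)`. -/
def SIA (Γ : SimpleGraph V) (m : ℕ) : Subgroup (MulAut (Raag Γ)) := SAut0 Γ ⊓ IAm Γ m

/-- The group of inner automorphisms of `A_Γ`. -/
def innSub (Γ : SimpleGraph V) : Subgroup (MulAut (Raag Γ)) :=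
  (MulAut.conj : Raag Γ →* MulAut (Raag Γ)).range


/-- Property (NL): three pairwise distinct, pairwise non-adjacent vertices with
`v₃ ≤ v₁` and `v₃ ≤ v₂`. -/
def NL (Γ : SimpleGraph V) : Prop :=
  ∃ v₁ v₂ v₃ : V, v₁ ≠ v₂ ∧ v₁ ≠ v₃ ∧ v₂ ≠ v₃ ∧
    ¬ Γ.Adj v₁ v₂ ∧ ¬ Γ.Adj v₁ v₃ ∧ ¬ Γ.Adj v₂ v₃ ∧ Le Γ v₃ v₁ ∧ Le Γ v₃ v₂

open Classical in
/-- The multiset of cardinalities of the equivalence classes of vertices under `∼`. -/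
noncomputable def classSizes (Γ : SimpleGraph V) : Multiset ℕ :=
  (Finset.image (fun v => Set.toFinset (simClass Γ v)) Finset.univ).val.map Finset.card

theorem lift_rels_eq_one {G : Type*} [Group G] (Γ : SimpleGraph V) (f : V → G)
    (hf : ∀ u v, Γ.Adj u v → Commute (f u) (f v)) :
    ∀ r ∈ Rels Γ, FreeGroup.lift f r = 1 := by
  rintro _ ⟨u, v, huv, rfl⟩
  simp [(hf u v huv).eq]

/-- The homomorphism out of `Raag Γ` sending adjacent generators to commuting elements. -/
def raagLift {G : Type*} [Group G] (Γ : SimpleGraph V) (f : V → G)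
    (hf : ∀ u v, Γ.Adj u v → Commute (f u) (f v)) : Raag Γ →* G :=
  PresentedGroup.toGroup (lift_rels_eq_one Γ f hf)

theorem raagLift_gen {G : Type*} [Group G] (Γ : SimpleGraph V) (f : V → G)
    (hf : ∀ u v, Γ.Adj u v → Commute (f u) (f v)) (v : V) :
    raagLift Γ f hf (gen Γ v) = f v :=
  PresentedGroup.toGroup.of _

theorem commute_gen (Γ : SimpleGraph V) {u v : V} (huv : Γ.Adj u v) :
    Commute (gen Γ u) (gen Γ v) := by
  have h : (PresentedGroup.mk (Rels Γ))
      (FreeGroup.of u * FreeGroup.of v * (FreeGroup.of u)⁻¹ * (FreeGroup.of v)⁻¹) = 1 :=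
    PresentedGroup.one_of_mem ⟨u, v, huv, rfl⟩
  simp only [map_mul, map_inv] at h
  exact (mul_inv_eq_iff_eq_mul.mp (mul_inv_eq_one.mp h))

/-- The endomorphism of `Raag Γ` that multiplies the generator `v` by `g` on the right and
fixes all other generators, where `g` commutes with the link of `v`. -/
def transvectionHom (Γ : SimpleGraph V) (v : V) (g : Raag Γ)
    (hg : ∀ u, Γ.Adj u v → Commute (gen Γ u) g) : Raag Γ →* Raag Γ :=
  raagLift Γ (fun z => if z = v then gen Γ z * g else gen Γ z) (by
    intro a b hab
    have hc := commute_gen Γ hab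
    by_cases ha : a = v
    · subst ha
      simpa [hab.ne'] using hc.mul_left (hg b hab.symm).symm
    · by_cases hb : b = v
      · subst hb
        simpa [ha] using hc.mul_right (hg a hab)
      · simpa [ha, hb] using hc)

theorem transvectionHom_gen_self (Γ : SimpleGraph V) (v : V) (g : Raag Γ)
    (hg : ∀ u, Γ.Adj u v → Commute (gen Γ u) g) :
    transvectionHom Γ v g hg (gen Γ v) = gen Γ v * g := by
  simp [transvectionHom, raagLift_gen]

theorem transvectionHom_gen_of_ne (Γ : SimpleGraph V) (v : V) (g : Raag Γ)
    (hg : ∀ u, Γ.Adj u v → Commute (gen Γ u) g) {z : V} (hz : z ≠ v) :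
    transvectionHom Γ v g hg (gen Γ z) = gen Γ z := by
  simp [transvectionHom, raagLift_gen, hz]

theorem transvectionHom_comp_inv (Γ : SimpleGraph V) (v : V) (g h : Raag Γ)
    (hg : ∀ u, Γ.Adj u v → Commute (gen Γ u) g) (hh : ∀ u, Γ.Adj u v → Commute (gen Γ u) h)
    (hgh : g * h = 1) (hfix : transvectionHom Γ v g hg h = h) :
    (transvectionHom Γ v g hg).comp (transvectionHom Γ v h hh) = MonoidHom.id _ := by
  refine PresentedGroup.ext fun z => ?_
  change transvectionHom Γ v g hg (transvectionHom Γ v h hh (gen Γ z)) = gen Γ z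
  by_cases hz : z = v
  · subst hz
    rw [transvectionHom_gen_self, map_mul, hfix, transvectionHom_gen_self, mul_assoc, hgh, mul_one]
  · rw [transvectionHom_gen_of_ne _ _ _ _ hz, transvectionHom_gen_of_ne _ _ _ _ hz]

/-- If `v ≤ w` with `v`, `w` distinct and non-adjacent, the transvection `v ↦ v w` is an
automorphism. -/
theorem exists_transvection (Γ : SimpleGraph V) {v w : V} (hne : w ≠ v) (hadj : ¬ Γ.Adj w v)
    (hle : Le Γ v w) :
    ∃ α : MulAut (Raag Γ), α (gen Γ v) = gen Γ v * gen Γ w ∧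
      ∀ z : V, z ≠ v → α (gen Γ z) = gen Γ z := by
  have hg : ∀ u, Γ.Adj u v → Commute (gen Γ u) (gen Γ w) := by
    intro u hu
    rcases hle (show u ∈ lk Γ v from hu.symm) with rfl | h
    · exact absurd hu hadj
    · exact (commute_gen Γ h).symm
  have hg' : ∀ u, Γ.Adj u v → Commute (gen Γ u) (gen Γ w)⁻¹ := fun u hu => (hg u hu).inv_right
  refine ⟨MonoidHom.toMulEquiv (transvectionHom Γ v _ hg) (transvectionHom Γ v _ hg')
    (transvectionHom_comp_inv Γ v _ _ hg' hg (inv_mul_cancel _)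
      (transvectionHom_gen_of_ne Γ v _ hg' hne))
    (transvectionHom_comp_inv Γ v _ _ hg hg' (mul_inv_cancel _)
      (by rw [map_inv, transvectionHom_gen_of_ne Γ v _ hg hne])),
    transvectionHom_gen_self Γ v _ hg, fun z hz => transvectionHom_gen_of_ne Γ v _ hg hz⟩

/-- Distinct pairwise non-adjacent vertices generate a free subgroup, freely. -/
theorem lift_gen_injective {ι : Type*} (Γ : SimpleGraph V) (p : ι → V)
    (hp : Function.Injective p) (hadj : ∀ i j, ¬ Γ.Adj (p i) (p j)) :
    Function.Injective (FreeGroup.lift (fun i => gen Γ (p i)) : FreeGroup ι →* Raag Γ) := by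
  let f : V → FreeGroup ι := Function.extend p FreeGroup.of 1
  have hf : ∀ u v, Γ.Adj u v → Commute (f u) (f v) := by
    intro u v huv
    by_cases hu : ∃ i, p i = u
    · by_cases hv : ∃ j, p j = v
      · obtain ⟨i, rfl⟩ := hu
        obtain ⟨j, rfl⟩ := hv
        exact absurd huv (hadj i j)
      · simp [f, Function.extend_apply' _ _ _ hv]
    · simp [f, Function.extend_apply' _ _ _ hu]
  have hcomp : (raagLift Γ f hf).comp (FreeGroup.lift (fun i => gen Γ (p i))) =
      MonoidHom.id _ := by
    ext i
    simp [raagLift_gen, f, hp.extend_apply]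
  exact Function.LeftInverse.injective (DFunLike.congr_fun hcomp)

theorem Aut_contains_poison_subgroup_of_NL (Γ : SimpleGraph V) (hNL : NL Γ) :
    ∃ (x : Fin 3 → Raag Γ) (α : Fin 2 → MulAut (Raag Γ)),
      Function.Injective (FreeGroup.lift x : FreeGroup (Fin 3) →* Raag Γ) ∧
      (∀ i j : Fin 2, α i (x j.castSucc) = x j.castSucc) ∧
      (∀ i : Fin 2, α i (x 2) = x 2 * x i.castSucc) := by
  obtain ⟨v₁, v₂, v₃, h12, h13, h23, n12, n13, n23, le1, le2⟩ := hNL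
  obtain ⟨α₁, hα₁, hα₁'⟩ := exists_transvection Γ h13 n13 le1
  obtain ⟨α₂, hα₂, hα₂'⟩ := exists_transvection Γ h23 n23 le2
  refine ⟨fun i => gen Γ (![v₁, v₂, v₃] i), ![α₁, α₂], lift_gen_injective Γ _ ?_ ?_, ?_, ?_⟩
  · intro i j hij
    fin_cases i <;> fin_cases j <;> simp_all
  · intro i j
    fin_cases i <;> fin_cases j <;> simp_all [Γ.adj_comm]
  · intro i j
    fin_cases i <;> fin_cases j <;> simp [hα₁', hα₂', h13, h23]
  · intro i
    fin_cases i <;> simp [hα₁, hα₂]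

end RaagPaper
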